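/- For real numbers x and |s| < 1, ∑_{m=0}^{∞} ((s/2)^m / m!) · H_m(x)² = (1 - s²)^{-1/2} · exp(2s x² / (1+s)), where H_m is the m-th physicists' Hermite polynomial. -/

import Mathlib

/-- The physicists' Hermite polynomial `H_m(x) = (-1)^m e^{x²} (d/dx)^m e^{-x²}`. -/
noncomputable def physHermite (m : ℕ) (x : ℝ) : ℝ :=
  (-1) ^ m * Real.exp (x ^ 2) * iteratedDeriv m (fun y => Real.exp (-y ^ 2)) x

theorem iteratedDeriv_gaussian_succ_succ (m : ℕ) (x : ℝ) :
    iteratedDeriv (m + 2) (fun y : ℝ => Real.exp (-y ^ 2)) x =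
      -2 * x * iteratedDeriv (m + 1) (fun y : ℝ => Real.exp (-y ^ 2)) x -
        2 * (m + 1) * iteratedDeriv m (fun y : ℝ => Real.exp (-y ^ 2)) x := by
  have hsmooth : ContDiff ℝ ⊤ (fun y : ℝ => Real.exp (-y ^ 2)) := by fun_prop
  have hderiv (k : ℕ) (y : ℝ) :
      HasDerivAt (iteratedDeriv k (fun y : ℝ => Real.exp (-y ^ 2)))
        (iteratedDeriv (k + 1) (fun y : ℝ => Real.exp (-y ^ 2)) y) y := by
    rw [iteratedDeriv_succ]
    exact (hsmooth.differentiable_iteratedDeriv k (WithTop.coe_lt_top _) y).hasDerivAt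
  have hone : iteratedDeriv 1 (fun y : ℝ => Real.exp (-y ^ 2)) =
      fun y => -2 * y * Real.exp (-y ^ 2) := by
    funext y
    rw [iteratedDeriv_one, ((hasDerivAt_pow 2 y).fun_neg.exp).deriv]
    push_cast
    ring
  induction m generalizing x with
  | zero =>
    have h := ((hasDerivAt_id x).const_mul (-2)).fun_mul (hderiv 0 x)
    rw [iteratedDeriv_zero] at h
    simp only [id, ← hone] at h
    rw [(hderiv 1 x).unique h]
    simp
    ring
  | succ m ih =>
    have h := (((hasDerivAt_id x).const_mul (-2)).fun_mul (hderiv (m + 1) x)).fun_sub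
      ((hderiv m x).const_mul (2 * (m + 1 : ℝ)))
    simp only [id, ← ih] at h
    rw [(hderiv (m + 2) x).unique h]
    push_cast
    ring

theorem physHermite_zero (x : ℝ) : physHermite 0 x = 1 := by
  simp [physHermite, ← Real.exp_add]

theorem physHermite_one (x : ℝ) : physHermite 1 x = 2 * x := by
  rw [physHermite, iteratedDeriv_one, ((hasDerivAt_pow 2 x).fun_neg.exp).deriv, Real.exp_neg]
  field_simp
  norm_num [mul_comm]

theorem physHermite_succ_succ (m : ℕ) (x : ℝ) :
    physHermite (m + 2) x = 2 * x * physHermite (m + 1) x - 2 * (m + 1) * physHermite m x := by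
  simp only [physHermite, iteratedDeriv_gaussian_succ_succ]
  ring

/-- The normalized square `H_m(x)² / (2^m m!)`. -/
noncomputable def hermiteSq (x : ℝ) (m : ℕ) : ℝ :=
  physHermite m x ^ 2 / (2 ^ m * m.factorial)

theorem hermiteSq_succ_three (x : ℝ) (n : ℕ) :
    (n + 3) * hermiteSq x (n + 3) + (n + 2 - 2 * x ^ 2) * hermiteSq x (n + 2)
      - (n + 2 - 2 * x ^ 2) * hermiteSq x (n + 1) - (n + 1) * hermiteSq x n = 0 := by
  simp only [hermiteSq, physHermite_succ_succ (n + 1), physHermite_succ_succ n,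
    Nat.factorial_succ, pow_succ]
  push_cast
  have : ((n : ℝ) + 1) ≠ 0 := by positivity
  have : ((n : ℝ) + 1 + 1) ≠ 0 := by positivity
  have : ((n : ℝ) + 2 + 1) ≠ 0 := by positivity
  field_simp
  ring

/-- Multiplication by the variable, on sequences of power series coefficients. -/
def coeffShift (u : ℕ → ℂ) : ℕ → ℂ
  | 0 => 0
  | n + 1 => u n

theorem HasSum.coeffShift {u : ℕ → ℂ} {z a : ℂ} (h : HasSum (fun n => u n * z ^ n) a) :
    HasSum (fun n => coeffShift u n * z ^ n) (z * a) := by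
  rw [← hasSum_nat_add_iff' 1]
  simpa [_root_.coeffShift, pow_succ, mul_assoc, mul_comm, mul_left_comm] using h.mul_left z

theorem coeff_eq_zero_of_hasSum_zero {u : ℕ → ℂ} {r : ℝ} (hr : 0 < r)
    (h : ∀ z ∈ Metric.ball (0 : ℂ) r, HasSum (fun n => u n * z ^ n) 0) (n : ℕ) : u n = 0 := by
  have hp : HasFPowerSeriesAt (0 : ℂ → ℂ) (FormalMultilinearSeries.ofScalars ℂ u) 0 := by
    rw [hasFPowerSeriesAt_iff]
    filter_upwards [Metric.ball_mem_nhds 0 hr] with z hz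
    simpa [FormalMultilinearSeries.coeff_ofScalars, mul_comm] using h z hz
  rw [← FormalMultilinearSeries.coeff_ofScalars (𝕜 := ℂ) (p := u), hp.eq_zero]
  rfl

/-- The closed form of the diagonal Mehler kernel. -/
noncomputable def mehlerDiag (x : ℝ) (z : ℂ) : ℂ :=
  (1 - z ^ 2) ^ (-1 / 2 : ℂ) * Complex.exp (2 * z * x ^ 2 / (1 + z))

theorem one_add_ne_zero_of_norm_lt_one {z : ℂ} (hz : ‖z‖ < 1) : 1 + z ≠ 0 := by
  intro h
  rw [eq_neg_of_add_eq_zero_right h] at hz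
  simp at hz

theorem one_sub_sq_mem_slitPlane {z : ℂ} (hz : ‖z‖ < 1) : 1 - z ^ 2 ∈ Complex.slitPlane := by
  have h : ‖-z ^ 2‖ < 1 := by
    rw [norm_neg, norm_pow]
    exact pow_lt_one₀ (norm_nonneg z) hz two_ne_zero
  simpa [sub_eq_add_neg] using Complex.mem_slitPlane_of_norm_lt_one h

theorem hasDerivAt_mehlerDiag (x : ℝ) {z : ℂ} (hz : ‖z‖ < 1) :
    HasDerivAt (mehlerDiag x)
      ((z / (1 - z ^ 2) + 2 * x ^ 2 / (1 + z) ^ 2) * mehlerDiag x z) z := by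
  have hadd := one_add_ne_zero_of_norm_lt_one hz
  have hslit := one_sub_sq_mem_slitPlane hz
  have hsub := Complex.slitPlane_ne_zero hslit
  have hpow := ((hasDerivAt_pow 2 z).const_sub 1).cpow_const (c := (-1 / 2 : ℂ)) hslit
  have hexp := ((((hasDerivAt_id z).const_mul 2).mul_const ((x : ℂ) ^ 2)).fun_div
    ((hasDerivAt_id z).const_add 1) hadd).cexp
  refine (hpow.fun_mul hexp).congr_deriv ?_
  rw [Complex.cpow_sub _ _ hsub, Complex.cpow_one]
  simp only [mehlerDiag, id]
  field_simp
  push_cast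
  ring

theorem mehlerDiag_ode (x : ℝ) {z : ℂ} (hz : ‖z‖ < 1) :
    (1 + z - z ^ 2 - z ^ 3) * deriv (mehlerDiag x) z =
      (2 * x ^ 2 + (1 - 2 * x ^ 2) * z + z ^ 2) * mehlerDiag x z := by
  have hadd := one_add_ne_zero_of_norm_lt_one hz
  have hsub := Complex.slitPlane_ne_zero (one_sub_sq_mem_slitPlane hz)
  rw [(hasDerivAt_mehlerDiag x hz).deriv]
  field_simp
  ring

theorem differentiableOn_mehlerDiag (x : ℝ) :
    DifferentiableOn ℂ (mehlerDiag x) (Metric.ball 0 1) := fun _ hz =>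
  (hasDerivAt_mehlerDiag x (mem_ball_zero_iff.mp hz)).differentiableAt.differentiableWithinAt

/-- The Taylor coefficients of `mehlerDiag x` at the origin. -/
noncomputable def mehlerCoeff (x : ℝ) (n : ℕ) : ℂ :=
  iteratedDeriv n (mehlerDiag x) 0 / n.factorial

theorem hasSum_mehlerCoeff (x : ℝ) {z : ℂ} (hz : z ∈ Metric.ball (0 : ℂ) 1) :
    HasSum (fun n => mehlerCoeff x n * z ^ n) (mehlerDiag x z) := by
  refine (Complex.hasSum_taylorSeries_on_ball (differentiableOn_mehlerDiag x) hz).congr_fun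
    fun n => ?_
  simp [mehlerCoeff]
  ring

theorem hasSum_deriv_mehlerCoeff (x : ℝ) {z : ℂ} (hz : z ∈ Metric.ball (0 : ℂ) 1) :
    HasSum (fun n : ℕ => ((n + 1) * mehlerCoeff x (n + 1)) * z ^ n) (deriv (mehlerDiag x) z) := by
  refine (Complex.hasSum_taylorSeries_on_ball
    ((differentiableOn_mehlerDiag x).deriv Metric.isOpen_ball) hz).congr_fun fun n => ?_
  have : (n : ℂ) + 1 ≠ 0 := by exact_mod_cast n.succ_ne_zero
  simp [mehlerCoeff, iteratedDeriv_succ', Nat.factorial_succ]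
  field_simp

theorem mehlerCoeff_recurrence (x : ℝ) (n : ℕ) :
    let c := mehlerCoeff x
    let d : ℕ → ℂ := fun n => (n + 1) * mehlerCoeff x (n + 1)
    d n + coeffShift d n - coeffShift (coeffShift d) n - coeffShift (coeffShift (coeffShift d)) n
      - (2 * x ^ 2 * c n + (1 - 2 * x ^ 2) * coeffShift c n + coeffShift (coeffShift c) n) = 0 := by
  intro c d
  refine coeff_eq_zero_of_hasSum_zero (u := fun n => d n + coeffShift d n
    - coeffShift (coeffShift d) n - coeffShift (coeffShift (coeffShift d)) n
    - (2 * x ^ 2 * c n + (1 - 2 * x ^ 2) * coeffShift c n + coeffShift (coeffShift c) n))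
    one_pos (fun z hz => ?_) n
  have hc := hasSum_mehlerCoeff x hz
  have hd : HasSum (fun n => d n * z ^ n) _ := hasSum_deriv_mehlerCoeff x hz
  have h := (((hd.add hd.coeffShift).sub hd.coeffShift.coeffShift).sub
    hd.coeffShift.coeffShift.coeffShift).sub
    (((hc.mul_left (2 * (x : ℂ) ^ 2)).add (hc.coeffShift.mul_left (1 - 2 * (x : ℂ) ^ 2))).add
      hc.coeffShift.coeffShift)
  convert h using 1
  · rfl
  · funext n
    simp only [c]
    ring
  · linear_combination -(1 : ℂ) * mehlerDiag_ode x (mem_ball_zero_iff.mp hz)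

theorem mehlerCoeff_eq_hermiteSq (x : ℝ) (n : ℕ) : mehlerCoeff x n = hermiteSq x n := by
  have hzero : mehlerCoeff x 0 = hermiteSq x 0 := by
    simp [mehlerCoeff, mehlerDiag, hermiteSq, physHermite_zero]
  have hone : mehlerCoeff x 1 = hermiteSq x 1 := by
    have h := mehlerCoeff_recurrence x 0
    simp [coeffShift, hzero] at h
    simp [hermiteSq, physHermite_zero, physHermite_one] at h ⊢
    linear_combination h
  have htwo : mehlerCoeff x 2 = hermiteSq x 2 := by
    have h := mehlerCoeff_recurrence x 1
    simp [coeffShift, hzero, hone] at h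
    simp [hermiteSq, physHermite_zero, physHermite_one, physHermite_succ_succ] at h ⊢
    linear_combination h / 2
  induction n using Nat.strong_induction_on with
  | _ n ih =>
    match n with
    | 0 => exact hzero
    | 1 => exact hone
    | 2 => exact htwo
    | n + 3 =>
      have h := mehlerCoeff_recurrence x (n + 2)
      have h' := congrArg (fun r : ℝ => (r : ℂ)) (hermiteSq_succ_three x n)
      have hn : (n : ℂ) + 3 ≠ 0 := by exact_mod_cast (n + 2).succ_ne_zero
      refine mul_left_cancel₀ hn ?_
      rcases n with _ | n
      · simp only [coeffShift] at h
        push_cast at h h'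
        rw [ih 0 (by omega), ih 1 (by omega), ih 2 (by omega)] at h
        linear_combination h - h'
      · simp only [coeffShift] at h
        push_cast at h h' ⊢
        rw [ih (n + 1) (by omega), ih (n + 1 + 1) (by omega), ih (n + 1 + 2) (by omega)] at h
        linear_combination h - h'

theorem mehlerDiag_ofReal (x s : ℝ) (hs : |s| < 1) :
    mehlerDiag x s =
      ((1 / Real.sqrt (1 - s ^ 2) * Real.exp (2 * s * x ^ 2 / (1 + s)) : ℝ) : ℂ) := by
  have hpos : 0 ≤ 1 - s ^ 2 := by
    have := (sq_lt_one_iff_abs_lt_one s).mpr hs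
    linarith
  rw [Real.sqrt_eq_rpow, one_div, ← Real.rpow_neg hpos, Complex.ofReal_mul,
    Complex.ofReal_cpow hpos, mehlerDiag]
  push_cast
  norm_num

theorem mehler_diagonal (x s : ℝ) (hs : |s| < 1) :
    HasSum (fun m : ℕ => (s / 2) ^ m / m.factorial * (physHermite m x) ^ 2)
      (1 / Real.sqrt (1 - s ^ 2) * Real.exp (2 * s * x ^ 2 / (1 + s))) := by
  rw [← Complex.hasSum_ofReal, ← mehlerDiag_ofReal x s hs]
  have h := hasSum_mehlerCoeff x (z := s) (by simpa using hs)
  refine h.congr_fun fun m => ?_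
  rw [mehlerCoeff_eq_hermiteSq, hermiteSq]
  push_cast
  rw [div_pow]
  field_simp
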